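/- arXiv:0805.1974 — 6 statements merged into one kernel-verified Lean document; each statement's English description precedes it below -/
import Mathlib

section
/- For all natural numbers k ≥ 2 and l such that l ≥ 2k²/ln k (as real numbers), one has ⌈(2k+l)/k⌉ · C(k+l, k) > C(2k+l, k), where C(n, r) denotes the binomial coefficient and ⌈·⌉ is the ceiling of the rational number (2k+l)/k. -/
theorem Nat.choose_add_mul_pow_le (l a k : ℕ) :
    (l + a + k).choose k * l ^ k ≤ (l + a) ^ k * (l + k).choose k := by
  have h : (l + a + 1).ascFactorial k * l ^ k ≤ (l + a) ^ k * (l + 1).ascFactorial k := by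
    simp only [Nat.ascFactorial_eq_prod_range]
    rw [← Finset.card_range k, ← Finset.prod_const, ← Finset.prod_const,
      Finset.card_range, ← Finset.prod_mul_distrib, ← Finset.prod_mul_distrib]
    refine Finset.prod_le_prod' fun i _ => ?_
    nlinarith [Nat.zero_le (a * i), Nat.zero_le a]
  rw [Nat.ascFactorial_eq_factorial_mul_choose, Nat.ascFactorial_eq_factorial_mul_choose] at h
  refine Nat.le_of_mul_le_mul_left ?_ k.factorial_pos
  linarith

theorem Nat.choose_add_le_exp_mul_choose {l : ℕ} (hl : 0 < l) (a k : ℕ) :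
    ((l + a + k).choose k : ℝ) ≤ Real.exp (k * (a / l)) * (l + k).choose k := by
  have hl' : (0 : ℝ) < l := by exact_mod_cast hl
  have h : ((l + a + k).choose k : ℝ) * l ^ k ≤ (l + a) ^ k * (l + k).choose k := by
    exact_mod_cast Nat.choose_add_mul_pow_le l a k
  have hexp : (l + a : ℝ) ≤ l * Real.exp (a / l) := by
    calc (l + a : ℝ) = l * (a / l + 1) := by field_simp; ring
      _ ≤ l * Real.exp (a / l) := by gcongr; exact Real.add_one_le_exp _
  refine le_of_mul_le_mul_right (h.trans ?_) (pow_pos hl' k)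
  calc (l + a : ℝ) ^ k * (l + k).choose k
      ≤ (l * Real.exp (a / l)) ^ k * (l + k).choose k := by gcongr
    _ = _ := by rw [mul_pow, Real.exp_nat_mul]; ring

/-- Technical lemma (Lemma 3): for `k ≥ 2` and `l ≥ 2k²/ln k`,
`⌈(2k+l)/k⌉ · C(k+l, k) > C(2k+l, k)`. -/
theorem rcp_technical_lemma (k l : ℕ) (hk : 2 ≤ k)
    (hl : (l : ℝ) ≥ 2 * (k : ℝ) ^ 2 / Real.log k) :
    (⌈((2 * k + l : ℚ)) / (k : ℚ)⌉ : ℤ) * ((k + l).choose k : ℤ) >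
      ((2 * k + l).choose k : ℤ) := by
  have hk' : (2 : ℝ) ≤ k := by exact_mod_cast hk
  have hk0 : (0 : ℝ) < k := by linarith
  have hlog : 0 < Real.log k := Real.log_pos (by linarith)
  have hl0 : (0 : ℝ) < l := lt_of_lt_of_le (by positivity) hl
  have hkl : 2 * (k : ℝ) ^ 2 ≤ l * Real.log k := (div_le_iff₀ hlog).1 hl
  have hsqrt : Real.exp (k * (k / l)) ≤ √k := by
    rw [← Real.le_log_iff_exp_le (Real.sqrt_pos.2 hk0), Real.log_sqrt hk0.le, ← mul_div_assoc,
      div_le_div_iff₀ hl0 two_pos]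
    linarith
  have hlog_le : Real.log k ≤ 2 * √k := by
    have := Real.log_le_sub_one_of_pos (Real.sqrt_pos.2 hk0)
    rw [Real.log_sqrt hk0.le] at this
    linarith
  have hlt : √k < (2 * k + l) / k := by
    rw [lt_div_iff₀ hk0]
    have hs := Real.sq_sqrt hk0.le
    have hs0 := Real.sqrt_pos.2 hk0
    have : √k * k ≤ l := by
      refine le_of_mul_le_mul_right ?_ hs0
      nlinarith
    linarith
  have hceil : ((2 * k + l) / k : ℝ) ≤ (⌈((2 * k + l : ℚ)) / (k : ℚ)⌉ : ℤ) := by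
    have h := (Rat.cast_le (K := ℝ)).2 (Int.le_ceil ((2 * k + l : ℚ) / (k : ℚ)))
    simpa only [Rat.cast_div, Rat.cast_add, Rat.cast_mul, Rat.cast_ofNat, Rat.cast_natCast,
      Rat.cast_intCast] using h
  have hchoose := Nat.choose_add_le_exp_mul_choose (by exact_mod_cast hl0) k k (l := l)
  rw [show l + k + k = 2 * k + l by ring, add_comm l k] at hchoose
  have hpos : (0 : ℝ) < (k + l).choose k := by
    exact_mod_cast Nat.choose_pos (Nat.le_add_right k l)
  have key : ((2 * k + l).choose k : ℝ) <
      (⌈((2 * k + l : ℚ)) / (k : ℚ)⌉ : ℤ) * ((k + l).choose k : ℝ) :=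
    hchoose.trans_lt (mul_lt_mul_of_pos_right ((hsqrt.trans_lt hlt).trans_le hceil) hpos)
  exact_mod_cast key
end

section
/- For every natural number k ≥ 2 and every real number l with l ≥ 2k²/ln k, the real inequality (2k+l)/k > ((l+k)/l)^k holds. -/
/-- For `k ≥ 2` natural and real `l ≥ 2k²/ln k`, `(2k+l)/k > ((l+k)/l)^k`. -/
theorem rcp_key_real_inequality (k : ℕ) (hk : 2 ≤ k) (l : ℝ)
    (hl : l ≥ 2 * (k : ℝ) ^ 2 / Real.log k) :
    (2 * (k : ℝ) + l) / (k : ℝ) > ((l + (k : ℝ)) / l) ^ k := by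
  have hk2 : (2 : ℝ) ≤ k := by exact_mod_cast hk
  have hk0 : (0 : ℝ) < k := by linarith
  have hlog : 0 < Real.log k := Real.log_pos (by linarith)
  have hl0 : 0 < l := lt_of_lt_of_le (by positivity) hl
  have hmul : 2 * (k : ℝ) ^ 2 ≤ l * Real.log k := (div_le_iff₀ hlog).mp hl
  have hs : 0 < √(k : ℝ) := Real.sqrt_pos.mpr hk0
  have hss : √(k : ℝ) * √(k : ℝ) = k := Real.mul_self_sqrt hk0.le
  have hlog_half : Real.log k / 2 = Real.log √(k : ℝ) := (Real.log_sqrt hk0.le).symm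
  have hpow : ((l + k) / l) ^ k ≤ √(k : ℝ) := calc
    ((l + k) / l) ^ k ≤ Real.exp (k / l) ^ k := by
      gcongr
      rw [add_div, div_self hl0.ne', add_comm]
      exact Real.add_one_le_exp _
    _ = Real.exp (k * (k / l)) := (Real.exp_nat_mul _ _).symm
    _ ≤ Real.exp (Real.log √(k : ℝ)) := by
      rw [Real.exp_le_exp, ← hlog_half, ← mul_div_assoc, div_le_iff₀ hl0]
      linarith
    _ = √(k : ℝ) := Real.exp_log hs
  have hlog_le : Real.log k ≤ 2 * √(k : ℝ) := by
    linarith [Real.log_le_sub_one_of_pos hs]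
  have hlk : √(k : ℝ) * k ≤ l := by
    have h : l * Real.log k ≤ l * (2 * √(k : ℝ)) := by gcongr
    refine le_of_mul_le_mul_right ?_ hs
    calc √(k : ℝ) * k * √(k : ℝ) = (k : ℝ) ^ 2 := by linear_combination (k : ℝ) * hss
      _ ≤ l * √(k : ℝ) := by linarith
  refine lt_of_le_of_lt hpow ?_
  rw [lt_div_iff₀ hk0]
  linarith
end

section
/- Let k and l be natural numbers and let U be a finite set with |U| = 2k+l. Let 𝒯 be a finite family of k-element subsets of U such that |𝒯| · C(k+l, k) > C(2k+l, k). Then there exist two distinct sets A₁, A₂ ∈ 𝒯 and a k-element subset B of U with B ∩ A₁ = ∅ and B ∩ A₂ = ∅. -/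
/-- Counting/pigeonhole step of Lemma 4: if `|𝒯| · C(k+l,k) > C(2k+l,k)` for a
family `𝒯` of `k`-subsets of a `(2k+l)`-set `U`, then some `k`-subset `B` of `U`
is disjoint from two distinct members of `𝒯`. -/
theorem rcp_two_disjoint_hands {α : Type*} [DecidableEq α]
    (k l : ℕ) (U : Finset α) (hU : U.card = 2 * k + l)
    (𝒯 : Finset (Finset α))
    (h𝒯 : ∀ A ∈ 𝒯, A ⊆ U ∧ A.card = k)
    (hcount : 𝒯.card * (k + l).choose k > (2 * k + l).choose k) :
    ∃ A₁ ∈ 𝒯, ∃ A₂ ∈ 𝒯, A₁ ≠ A₂ ∧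
      ∃ B ⊆ U, B.card = k ∧ B ∩ A₁ = ∅ ∧ B ∩ A₂ = ∅ := by
  by_contra! h
  have hdisj : (𝒯 : Set (Finset α)).PairwiseDisjoint fun A => (U \ A).powersetCard k := by
    intro A₁ h₁ A₂ h₂ hne
    refine Finset.disjoint_left.2 fun B hB₁ hB₂ => ?_
    obtain ⟨hs₁, hk⟩ := Finset.mem_powersetCard.1 hB₁
    obtain ⟨hs₂, -⟩ := Finset.mem_powersetCard.1 hB₂
    obtain ⟨hBU, hd₁⟩ := Finset.subset_sdiff.1 hs₁
    obtain ⟨-, hd₂⟩ := Finset.subset_sdiff.1 hs₂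
    have hB := h A₁ h₁ A₂ h₂ hne B hBU hk (Finset.disjoint_iff_inter_eq_empty.1 hd₁)
    exact hB.ne_empty (Finset.disjoint_iff_inter_eq_empty.1 hd₂)
  have hcard : ∀ A ∈ 𝒯, ((U \ A).powersetCard k).card = (k + l).choose k := by
    intro A hA
    obtain ⟨hAU, hAk⟩ := h𝒯 A hA
    rw [Finset.card_powersetCard, Finset.card_sdiff_of_subset hAU, hU, hAk]
    congr 1
    omega
  have hsub : (𝒯.biUnion fun A => (U \ A).powersetCard k) ⊆ U.powersetCard k :=
    Finset.biUnion_subset.2 fun A _ => Finset.powersetCard_mono Finset.sdiff_subset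
  have hle := Finset.card_le_card hsub
  rw [Finset.card_biUnion hdisj, Finset.sum_const_nat hcard, Finset.card_powersetCard, hU] at hle
  exact hle.not_gt hcount
end

section
/- Let k ≥ 2 and l be natural numbers with l ≥ 2k²/ln k (as real numbers), and let U be a finite set with |U| = 2k+l. Let 𝒯 be a finite family of k-element subsets of U whose union is all of U (i.e., ⋃_{A ∈ 𝒯} A = U). Then there exist two distinct sets A₁, A₂ ∈ 𝒯 and a k-element subset B of U with B ∩ A₁ = ∅ and B ∩ A₂ = ∅. -/
/-- Lemma 4 of the paper: for `k ≥ 2` and `l ≥ 2k²/ln k`, any family of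
`k`-subsets of a `(2k+l)`-set `U` covering `U` has two distinct members
disjoint from a common `k`-subset `B` of `U`. -/
theorem rcp_indistinguishable_states {α : Type*} [DecidableEq α]
    (k l : ℕ) (hk : 2 ≤ k) (hl : (l : ℝ) ≥ 2 * (k : ℝ) ^ 2 / Real.log k)
    (U : Finset α) (hU : U.card = 2 * k + l)
    (𝒯 : Finset (Finset α))
    (h𝒯 : ∀ A ∈ 𝒯, A ⊆ U ∧ A.card = k)
    (hcover : 𝒯.biUnion id = U) :
    ∃ A₁ ∈ 𝒯, ∃ A₂ ∈ 𝒯, A₁ ≠ A₂ ∧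
      ∃ B ⊆ U, B.card = k ∧ B ∩ A₁ = ∅ ∧ B ∩ A₂ = ∅ := by
  have hk2 : (2 : ℝ) ≤ k := by exact_mod_cast hk
  have hlog : 0 < Real.log k := Real.log_pos (by linarith)
  have hkl : k ≤ l := by
    have hlogk : Real.log k ≤ k := Real.log_le_self (by linarith)
    have h : (k : ℝ) ≤ 2 * (k : ℝ) ^ 2 / Real.log k := by
      rw [le_div_iff₀ hlog]
      nlinarith
    exact_mod_cast h.trans hl
  obtain ⟨x, hx⟩ : U.Nonempty := Finset.card_pos.mp (by omega)
  obtain ⟨A₁, hA₁, -⟩ := Finset.mem_biUnion.mp (hcover ▸ hx)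
  obtain ⟨y, hyU, hyA₁⟩ : ∃ y ∈ U, y ∉ A₁ :=
    Finset.exists_mem_notMem_of_card_lt_card (by rw [(h𝒯 A₁ hA₁).2]; omega)
  obtain ⟨A₂, hA₂, hyA₂⟩ := Finset.mem_biUnion.mp (hcover ▸ hyU)
  obtain ⟨B, hB, hBcard⟩ : ∃ B ⊆ U \ (A₁ ∪ A₂), B.card = k := by
    apply Finset.exists_subset_card_eq
    have h₁ := Finset.le_card_sdiff (A₁ ∪ A₂) U
    have h₂ := Finset.card_union_le A₁ A₂
    rw [(h𝒯 A₁ hA₁).2, (h𝒯 A₂ hA₂).2] at h₂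
    omega
  obtain ⟨hBU, hBA⟩ := Finset.subset_sdiff.mp hB
  obtain ⟨hBA₁, hBA₂⟩ := Finset.disjoint_union_right.mp hBA
  exact ⟨A₁, hA₁, A₂, hA₂, fun h => hyA₁ (h ▸ hyA₂), B, hBU, hBcard,
    Finset.disjoint_iff_inter_eq_empty.mp hBA₁, Finset.disjoint_iff_inter_eq_empty.mp hBA₂⟩
end

section
/- Let k ≥ 1 and l ≥ 1 be natural numbers, let U be a finite set with |U| = 2k+l, and let W be the set of deals (A, B, C) of subsets of U with |A| = |B| = k, |C| = l, and A ∪ B ∪ C = U. Let Σ be an arbitrary type, let f : W → Σ be any function such that f(A, B, C) = f(A, B', C') for any two deals sharing the same first component (a deterministic public announcement by player a depends only on her own hand), and let w* = (A*, B*, C*) ∈ W. Then there exists a deal w = (A*, B, C) ∈ W with w ≠ w*, B ≠ B*, and f(w) = f(w*). Hence for every k ≥ 1 and l ≥ 1 there is no single-announcement solution to RCP(k;l). -/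
/-- Generalization of Theorem 1: for every `k ≥ 1` and `l ≥ 1` there is no
single-announcement solution to RCP(k;l). -/
theorem rcpkl_no_single_announcement {α S : Type*} [DecidableEq α]
    (k l : ℕ) (hk : 1 ≤ k) (hl : 1 ≤ l)
    (U : Finset α) (hU : U.card = 2 * k + l)
    (f : Finset α → Finset α → Finset α → S)
    (hf : ∀ A B C B' C',
      (A.card = k ∧ B.card = k ∧ C.card = l ∧ A ∪ B ∪ C = U) →
      (A.card = k ∧ B'.card = k ∧ C'.card = l ∧ A ∪ B' ∪ C' = U) →
      f A B C = f A B' C')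
    (A' B' C' : Finset α)
    (hw : A'.card = k ∧ B'.card = k ∧ C'.card = l ∧ A' ∪ B' ∪ C' = U) :
    ∃ B C : Finset α,
      (A'.card = k ∧ B.card = k ∧ C.card = l ∧ A' ∪ B ∪ C = U) ∧
      (B, C) ≠ (B', C') ∧ B ≠ B' ∧ f A' B C = f A' B' C' := by
  obtain ⟨hA, hB, hC, hABC⟩ := hw
  have hdisj : Disjoint B' C' := by
    have h₁ := Finset.card_union_le A' (B' ∪ C')
    have h₂ := Finset.card_union_le B' C'
    rw [← Finset.union_assoc, hABC] at h₁
    exact Finset.card_union_eq_card_add_card.mp (by omega)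
  obtain ⟨b, hb⟩ : B'.Nonempty := Finset.card_pos.mp (by omega)
  obtain ⟨c, hc⟩ : C'.Nonempty := Finset.card_pos.mp (by omega)
  have hbC : b ∉ C' := Finset.disjoint_left.mp hdisj hb
  have hcB : c ∉ B' := Finset.disjoint_right.mp hdisj hc
  have hne : insert c (B'.erase b) ≠ B' := fun h =>
    hcB (h ▸ Finset.mem_insert_self c (B'.erase b))
  have hdeal : A'.card = k ∧ (insert c (B'.erase b)).card = k ∧
      (insert b (C'.erase c)).card = l ∧
      A' ∪ insert c (B'.erase b) ∪ insert b (C'.erase c) = U := by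
    refine ⟨hA, ?_, ?_, ?_⟩
    · rw [Finset.card_insert_of_notMem (fun h => hcB (Finset.mem_of_mem_erase h)),
        Finset.card_erase_add_one hb, hB]
    · rw [Finset.card_insert_of_notMem (fun h => hbC (Finset.mem_of_mem_erase h)),
        Finset.card_erase_add_one hc, hC]
    · rw [← hABC]
      ext x
      simp only [Finset.mem_union, Finset.mem_insert, Finset.mem_erase]
      grind
  exact ⟨_, _, hdeal, fun h => hne (congrArg Prod.fst h), hne,
    hf _ _ _ _ _ hdeal ⟨hA, hB, hC, hABC⟩⟩
end

section
/- Let k ≥ 2 and l be natural numbers with l ≥ 2k²/ln k (as real numbers), let U be a finite set with |U| = 2k+l, let W be the set of deals (A, B, C) of subsets of U with |A| = |B| = k, |C| = l, and A ∪ B ∪ C = U, and let w* = (A*, B*, C*) ∈ W be the actual deal. Let Σ be an arbitrary type and let f be any function from the k-element subsets of U to Σ (player a's first announcement, depending only on her hand) such that the family 𝒯 = {A : A is a k-element subset of U and f(A) = f(A*)} of hands consistent with the actual announcement satisfies ⋃_{A ∈ 𝒯} A = U. Then there exist two distinct deals (A₁, B, C₁), (A₂, B, C₂) ∈ W with A₁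 ≠ A₂, equal second component B, and f(A₁) = f(A₂) = f(A*). Consequently any second announcement by player b — being a function of her hand B and the first announcement — takes the same value on both deals, so the two deals remain indistinguishable for player b after both announcements and she cannot learn player a's hand: no two-announcement scheme solves RCP(k;l). -/
/-- Two `k`-sets inside a set of size `2k + l` with `k ≤ l` leave room for a common
disjoint `k`-set. -/
theorem exists_common_disjoint_card {α : Type*} [DecidableEq α] {k l : ℕ} (hkl : k ≤ l)
    {U A₁ A₂ : Finset α} (hU : U.card = 2 * k + l) (h₁ : A₁.card = k) (h₂ : A₂.card = k) :
    ∃ B ⊆ U, B.card = k ∧ Disjoint A₁ B ∧ Disjoint A₂ B := by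
  have hcard : k ≤ (U \ (A₁ ∪ A₂)).card := by
    have := Finset.le_card_sdiff (A₁ ∪ A₂) U
    have := Finset.card_union_le A₁ A₂
    omega
  obtain ⟨B, hB, hBk⟩ := Finset.exists_subset_card_eq hcard
  have hdisj : Disjoint (A₁ ∪ A₂) B := Finset.disjoint_of_subset_right hB Finset.disjoint_sdiff
  rw [Finset.disjoint_union_left] at hdisj
  exact ⟨B, hB.trans Finset.sdiff_subset, hBk, hdisj⟩

/-- Disjoint hands of size `k` complete to a deal. -/
theorem card_sdiff_union_and_union_eq {α : Type*} [DecidableEq α] {k l : ℕ}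
    {U A B : Finset α} (hU : U.card = 2 * k + l) (hAU : A ⊆ U) (hBU : B ⊆ U)
    (hA : A.card = k) (hB : B.card = k) (hAB : Disjoint A B) :
    (U \ (A ∪ B)).card = l ∧ A ∪ B ∪ U \ (A ∪ B) = U := by
  refine ⟨?_, Finset.union_sdiff_of_subset (Finset.union_subset hAU hBU)⟩
  rw [Finset.card_sdiff_of_subset (Finset.union_subset hAU hBU), Finset.card_union_of_disjoint hAB]
  omega

/-- The lower bound on `l` forces `k ≤ l`. -/
theorem le_of_two_mul_sq_div_log_le {k l : ℕ} (hk : 2 ≤ k)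
    (hl : 2 * (k : ℝ) ^ 2 / Real.log k ≤ l) : k ≤ l := by
  have hk' : (2 : ℝ) ≤ k := by exact_mod_cast hk
  have hpos : 0 < Real.log k := Real.log_pos (by linarith)
  have hlog : Real.log k ≤ k := Real.log_le_self (by linarith)
  have : (k : ℝ) ≤ 2 * (k : ℝ) ^ 2 / Real.log k := by
    rw [le_div_iff₀ hpos]
    nlinarith
  exact_mod_cast this.trans hl

/-- Theorem 2 of the paper: no two-announcement solution to RCP(k;l) for
`k ≥ 2` and `l ≥ 2k²/ln k`.  Player a's first announcement `f` is a function
of her hand; since it must be safe against player c, the family `𝒯` of hands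
consistent with it covers `U`.  Then two distinct deals share player b's hand
and the announcement value, and any second announcement by player b (a
function of her hand and the first announcement) cannot separate them. -/
theorem rcpkl_no_two_announcements {α S : Type*} [DecidableEq α]
    (k l : ℕ) (hk : 2 ≤ k) (hl : (l : ℝ) ≥ 2 * (k : ℝ) ^ 2 / Real.log k)
    (U : Finset α) (hU : U.card = 2 * k + l)
    (A' B' C' : Finset α)
    (hw : A'.card = k ∧ B'.card = k ∧ C'.card = l ∧ A' ∪ B' ∪ C' = U)
    (f : Finset α → S)
    (hcover :
      (⋃ A ∈ {A : Finset α | A ⊆ U ∧ A.card = k ∧ f A = f A'}, (A : Set α))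
        = (U : Set α)) :
    ∃ A₁ A₂ B C₁ C₂ : Finset α,
      (A₁.card = k ∧ B.card = k ∧ C₁.card = l ∧ A₁ ∪ B ∪ C₁ = U) ∧
      (A₂.card = k ∧ B.card = k ∧ C₂.card = l ∧ A₂ ∪ B ∪ C₂ = U) ∧
      A₁ ≠ A₂ ∧ f A₁ = f A' ∧ f A₂ = f A' ∧
      ∀ (S₂ : Type) (g : Finset α → S → S₂), g B (f A₁) = g B (f A₂) := by
  obtain ⟨hA', -, -, hUnion⟩ := hw
  have hkl : k ≤ l := le_of_two_mul_sq_div_log_le hk hl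
  have hA'U : A' ⊆ U := by
    rw [← hUnion, Finset.union_assoc]
    exact Finset.subset_union_left
  obtain ⟨x, hxU, hxA'⟩ := Finset.exists_mem_notMem_of_card_lt_card (s := A') (t := U) (by omega)
  have hx : x ∈ (U : Set α) := hxU
  rw [← hcover] at hx
  simp only [Set.mem_iUnion, Set.mem_ofPred_eq, Finset.mem_coe] at hx
  obtain ⟨A, ⟨hAU, hA, hfA⟩, hxA⟩ := hx
  obtain ⟨B, hBU, hB, hAB, hA'B⟩ := exists_common_disjoint_card hkl hU hA hA'
  obtain ⟨hC₁, hU₁⟩ := card_sdiff_union_and_union_eq hU hAU hBU hA hB hAB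
  obtain ⟨hC₂, hU₂⟩ := card_sdiff_union_and_union_eq hU hA'U hBU hA' hB hA'B
  refine ⟨A, A', B, U \ (A ∪ B), U \ (A' ∪ B), ⟨hA, hB, hC₁, hU₁⟩, ⟨hA', hB, hC₂, hU₂⟩, ?_, hfA,
    rfl, fun S₂ g => by rw [hfA]⟩
  rintro rfl
  exact hxA' hxA
end
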